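/- (Simultaneous approximation against the ⌈k/g⌉-target benchmark.) There exists a universal constant c > 0 such that the following holds in the common improvement capacity model with capacity Δ > 0. Let the agents be partitioned into groups G_1,…,G_g (each a finite multiset of positions in ℝ) and let k ≥ g be an integer. Then there exists a finite target set T ⊆ ℝ with |T| ≤ k such that for every group ℓ ∈ {1,…,g}: SW_ℓ(T) ≥ (c/g²)·OPT_ℓ^{⌈k/g⌉}, where OPT_ℓ^{m} is the maximum of SW_ℓ(T') over all finite T' ⊆ ℝ with |T'| ≤ m. -/

import Mathlib

/-- Improvement of an agent at position `p` with capacity `Δ` given target set `T`: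
the agent moves to the smallest target `τ ∈ T` with `p < τ ≤ p + Δ`, if any. -/
noncomputable def imp (Δ p : ℝ) (T : Finset ℝ) : ℝ :=
  if h : (T.filter (fun τ => p < τ ∧ τ ≤ p + Δ)).Nonempty then
    (T.filter (fun τ => p < τ ∧ τ ≤ p + Δ)).min' h - p
  else 0

/-- Social welfare of a finite multiset `A` of agent positions sharing common capacity `Δ`. -/
noncomputable def swM (Δ : ℝ) (A : Multiset ℝ) (T : Finset ℝ) : ℝ :=
  (A.map (fun p => imp Δ p T)).sum

open Classical in
/-- Number of agents of `A` whose label under `f` lies in `B`. -/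
noncomputable def cnt (A : Multiset ℝ) (f : ℝ → ℤ) (B : Finset ℤ) : ℕ :=
  (A.map (fun p => if f p ∈ B then 1 else 0)).sum

lemma cnt_zero (f : ℝ → ℤ) (B : Finset ℤ) : cnt 0 f B = 0 := by simp [cnt]

open Classical in
lemma cnt_cons (a : ℝ) (A : Multiset ℝ) (f : ℝ → ℤ) (B : Finset ℤ) :
    cnt (a ::ₘ A) f B = (if f a ∈ B then 1 else 0) + cnt A f B := by simp [cnt]

lemma cnt_le_card (A : Multiset ℝ) (f : ℝ → ℤ) (B : Finset ℤ) : cnt A f B ≤ A.card := by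
  induction A using Multiset.induction_on with
  | empty => simp [cnt_zero]
  | cons a A ih => rw [cnt_cons, Multiset.card_cons]; split_ifs <;> omega

lemma cnt_mono (A : Multiset ℝ) (f : ℝ → ℤ) {B C : Finset ℤ} (h : B ⊆ C) :
    cnt A f B ≤ cnt A f C := by
  induction A using Multiset.induction_on with
  | empty => simp [cnt_zero]
  | cons a A ih =>
    rw [cnt_cons, cnt_cons]
    have := @h (f a)
    split_ifs <;> first | omega | tauto

lemma cnt_union (A : Multiset ℝ) (f : ℝ → ℤ) (B C : Finset ℤ) :
    cnt A f (B ∪ C) ≤ cnt A f B + cnt A f C := by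
  induction A using Multiset.induction_on with
  | empty => simp [cnt_zero]
  | cons a A ih =>
    rw [cnt_cons, cnt_cons, cnt_cons]
    have := @Finset.mem_union _ _ B C (f a)
    split_ifs <;> first | omega | tauto

lemma cnt_sum (A : Multiset ℝ) (f : ℝ → ℤ) (B : Finset ℤ) :
    cnt A f B = ∑ i ∈ B, cnt A f {i} := by
  induction A using Multiset.induction_on with
  | empty => simp [cnt_zero]
  | cons a A ih =>
    simp only [cnt_cons, Finset.sum_add_distrib, ← ih]
    simp

/-- Best `q` labels. -/
lemma exists_best (A : Multiset ℝ) (f : ℝ → ℤ) (q : ℕ) :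
    ∃ B : Finset ℤ, B.card ≤ q ∧ ∀ C : Finset ℤ, C.card ≤ q → cnt A f C ≤ cnt A f B := by
  have hne : ({n | ∃ B : Finset ℤ, B.card ≤ q ∧ cnt A f B = n} : Set ℕ).Nonempty :=
    ⟨_, ∅, by simp, rfl⟩
  have hbd : BddAbove ({n | ∃ B : Finset ℤ, B.card ≤ q ∧ cnt A f B = n} : Set ℕ) := by
    refine ⟨A.card, ?_⟩
    rintro n ⟨B, _, rfl⟩
    exact cnt_le_card A f B
  obtain ⟨B, hB, hs⟩ := Nat.sSup_mem hne hbd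
  refine ⟨B, hB, fun C hC => ?_⟩
  rw [hs]
  exact le_csSup hbd ⟨C, hC, rfl⟩

lemma best_mul (A : Multiset ℝ) (f : ℝ → ℤ) (q b : ℕ)
    (hb : ∀ C : Finset ℤ, C.card ≤ q → cnt A f C ≤ b) (n : ℕ) :
    ∀ C : Finset ℤ, C.card ≤ n * q → cnt A f C ≤ n * b := by
  induction n with
  | zero =>
    intro C hC
    have : C = ∅ := by simpa using hC
    subst this
    rw [cnt_sum]; simp
  | succ n ih =>
    intro C hC
    obtain ⟨D, hDC, hD⟩ := Finset.exists_subset_card_eq (s := C) (n := min q C.card)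
      (min_le_right _ _)
    have h1 := hb D (by omega)
    have h2 := ih (C \ D) (by
      rw [Finset.card_sdiff_of_subset hDC, hD]
      rw [Nat.succ_mul] at hC
      omega)
    have h3 := cnt_union A f (C \ D) D
    rw [Finset.sdiff_union_of_subset hDC] at h3
    rw [Nat.succ_mul]; omega

lemma imp_nonneg (Δ p : ℝ) (T : Finset ℝ) : 0 ≤ imp Δ p T := by
  unfold imp
  split_ifs with h
  · have := Finset.min'_mem _ h
    rw [Finset.mem_filter] at this
    linarith [this.2.1]
  · exact le_rfl

/-- Upper bound on welfare. -/
lemma sw_upper (Δ : ℝ) (A : Multiset ℝ) (T : Finset ℝ) (f : ℝ → ℤ) (B : Finset ℤ)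
    (hΔ : 0 < Δ) (h : ∀ p, ∀ τ ∈ T, p < τ → τ ≤ p + Δ → f p ∈ B) :
    swM Δ A T ≤ Δ * cnt A f B := by
  induction A using Multiset.induction_on with
  | empty => simp [cnt_zero, swM]
  | cons a A ih =>
    have e : swM Δ (a ::ₘ A) T = imp Δ a T + swM Δ A T := by simp [swM]
    rw [e, cnt_cons]
    have : imp Δ a T ≤ Δ * ((if f a ∈ B then 1 else 0 : ℕ) : ℝ) := by
      unfold imp
      split_ifs with h1 h2 h2
      · have := Finset.min'_mem _ h1
        rw [Finset.mem_filter] at this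
        push_cast; linarith [this.2.2]
      · exfalso
        obtain ⟨τ, hτ⟩ := h1
        rw [Finset.mem_filter] at hτ
        exact h2 (h a τ hτ.1 hτ.2.1 hτ.2.2)
      · simp [hΔ.le]
      · simp
    push_cast at this ⊢
    linarith

lemma sw_lower (Δ δ : ℝ) (A : Multiset ℝ) (T : Finset ℝ) (f : ℝ → ℤ) (S : Finset ℤ)
    (h : ∀ p, f p ∈ S → δ ≤ imp Δ p T) :
    δ * cnt A f S ≤ swM Δ A T := by
  induction A using Multiset.induction_on with
  | empty => simp [cnt_zero, swM]
  | cons a A ih =>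
    have e : swM Δ (a ::ₘ A) T = imp Δ a T + swM Δ A T := by simp [swM]
    rw [e, cnt_cons]
    have : δ * ((if f a ∈ S then 1 else 0 : ℕ) : ℝ) ≤ imp Δ a T := by
      split_ifs with h1
      · simpa using h a h1
      · simpa using imp_nonneg Δ a T
    push_cast at this ⊢
    linarith

/-- In each block there is a cell with at least `1/M` of the agents. -/
lemma best_cell (A : Multiset ℝ) (f : ℝ → ℤ) (M : ℕ) (hM : 0 < M) (i : ℤ) :
    ∃ j : ℤ, j / (M : ℤ) = i ∧ cnt A (fun p => f p / (M : ℤ)) {i} ≤ M * cnt A f {j} := by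
  have hM' : (0 : ℤ) < M := by exact_mod_cast hM
  have hiff : ∀ j : ℤ, j ∈ Finset.Ico (i * M) (i * M + M) ↔ j / (M : ℤ) = i := by
    intro j
    rw [Finset.mem_Ico, Int.ediv_eq_iff_of_pos hM']
  have hcard : (Finset.Ico (i * M) (i * M + M)).card = M := by simp
  have he : cnt A (fun p => f p / (M : ℤ)) {i} = cnt A f (Finset.Ico (i * M) (i * M + M)) := by
    unfold cnt
    simp only [hiff, Finset.mem_singleton]
  obtain ⟨j, hj, hmax⟩ := Finset.exists_max_image (Finset.Ico (i * M) (i * M + M))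
    (fun j => cnt A f {j}) (Finset.card_pos.mp (by omega))
  refine ⟨j, (hiff j).1 hj, ?_⟩
  rw [he, cnt_sum]
  have := Finset.sum_le_card_nsmul _ _ _ hmax
  rwa [hcard, smul_eq_mul] at this

/-- Next unselected cell. -/
lemma next_free (S : Finset ℤ) (g M : ℕ) (hM : 2 * g + 1 ≤ M)
    (hS : ∀ i : ℤ, (S.filter (fun j => j / (M : ℤ) = i)).card ≤ g) (j : ℤ) :
    ∃ j' : ℤ, j ≤ j' ∧ j' ≤ j + 2 * g ∧ j' ∉ S := by
  by_contra! hcon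
  have hM' : (0 : ℤ) < M := by omega
  have hsub : Finset.Icc j (j + 2 * g) ⊆
      S.filter (fun x => x / (M : ℤ) = j / (M : ℤ)) ∪
      S.filter (fun x => x / (M : ℤ) = j / (M : ℤ) + 1) := by
    intro x hx
    rw [Finset.mem_Icc] at hx
    have hxS := hcon x hx.1 hx.2
    have h1 : j / (M : ℤ) ≤ x / (M : ℤ) := Int.ediv_le_ediv hM' hx.1
    have h2 : x / (M : ℤ) ≤ j / (M : ℤ) + 1 := by
      have := Int.ediv_le_ediv hM' (show x ≤ j + 1 * (M : ℤ) by omega)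
      rwa [Int.add_mul_ediv_right _ _ hM'.ne'] at this
    rw [Finset.mem_union, Finset.mem_filter, Finset.mem_filter]
    have : x / (M : ℤ) = j / (M : ℤ) ∨ x / (M : ℤ) = j / (M : ℤ) + 1 := by omega
    tauto
  have h := (Finset.card_le_card hsub).trans (Finset.card_union_le _ _)
  have h1 := hS (j / (M : ℤ))
  have h2 := hS (j / (M : ℤ) + 1)
  rw [Int.card_Icc] at h
  omega

/-- simultaneous `Ω(1/g²)`-approximation against the `⌈k/g⌉`-target
benchmark for each group, in the common improvement capacity model. -/
theorem simultaneous_approx_small_benchmark :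
    ∃ c : ℝ, 0 < c ∧
      ∀ (Δ : ℝ), 0 < Δ →
      ∀ (g : ℕ), 1 ≤ g →
      ∀ (G : Fin g → Multiset ℝ),
      ∀ (k : ℕ), g ≤ k →
        ∃ T : Finset ℝ, T.card ≤ k ∧
          ∀ ℓ : Fin g, ∀ T' : Finset ℝ, T'.card ≤ (k + g - 1) / g →
            (c / (g : ℝ) ^ 2) * swM Δ (G ℓ) T' ≤ swM Δ (G ℓ) T := by
  refine ⟨1 / 64, by norm_num, ?_⟩
  intro Δ hΔ g hg G k hk
  obtain ⟨M, hMdef⟩ : ∃ M : ℕ, M = 4 * g := ⟨_, rfl⟩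
  obtain ⟨q, hq⟩ : ∃ q : ℕ, q = k / g := ⟨_, rfl⟩
  have hMpos : 0 < M := by omega
  have hMz : (0 : ℤ) < M := by exact_mod_cast hMpos
  have hMr : (0 : ℝ) < M := by exact_mod_cast hMpos
  have hgr : (1 : ℝ) ≤ g := by exact_mod_cast hg
  have hMg : (M : ℝ) = 4 * g := by rw [hMdef]; push_cast; ring
  obtain ⟨δ, hδdef⟩ : ∃ δ : ℝ, δ = Δ / M := ⟨_, rfl⟩
  have hδ : 0 < δ := by rw [hδdef]; positivity
  have hΔδ : Δ = M * δ := by rw [hδdef]; field_simp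
  obtain ⟨cell, hcell⟩ : ∃ cell : ℝ → ℤ, ∀ p, cell p = ⌊p / δ⌋ := ⟨_, fun _ => rfl⟩
  have hc1 : ∀ p, (cell p : ℝ) * δ ≤ p := fun p => by
    rw [hcell, ← le_div_iff₀ hδ]; exact Int.floor_le _
  have hc2 : ∀ p, p < ((cell p : ℝ) + 1) * δ := fun p => by
    rw [hcell, ← div_lt_iff₀ hδ]; exact Int.lt_floor_add_one _
  choose B hBc hBm using fun ℓ => exists_best (G ℓ) (fun p => cell p / (M : ℤ)) q
  choose r hr1 hr2 using fun ℓ => best_cell (G ℓ) cell M hMpos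
  set S : Finset ℤ := Finset.univ.biUnion (fun ℓ => (B ℓ).image (r ℓ)) with hSdef
  have hScard : S.card ≤ k := by
    calc S.card ≤ ∑ ℓ : Fin g, ((B ℓ).image (r ℓ)).card := Finset.card_biUnion_le
      _ ≤ ∑ ℓ : Fin g, q := Finset.sum_le_sum fun ℓ _ => Finset.card_image_le.trans (hBc ℓ)
      _ = g * q := by simp
      _ ≤ k := by rw [hq]; exact Nat.mul_div_le k g
  have hSblk : ∀ i : ℤ, (S.filter (fun j => j / (M : ℤ) = i)).card ≤ g := by
    intro i
    have hsub : S.filter (fun j => j / (M : ℤ) = i) ⊆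
        (Finset.univ : Finset (Fin g)).image (fun ℓ => r ℓ i) := by
      intro j hj
      simp only [hSdef, Finset.mem_filter, Finset.mem_biUnion, Finset.mem_image,
        Finset.mem_univ, true_and] at hj ⊢
      obtain ⟨⟨ℓ, i', _, rfl⟩, h2⟩ := hj
      rw [hr1] at h2
      exact ⟨ℓ, by rw [h2]⟩
    calc _ ≤ _ := Finset.card_le_card hsub
      _ ≤ (Finset.univ : Finset (Fin g)).card := Finset.card_image_le
      _ = g := by simp
  choose nx hn1 hn2 hn3 using next_free S g M (by omega) hSblk
  refine ⟨S.image (fun j => ((nx j : ℝ) + 1) * δ), Finset.card_image_le.trans hScard, ?_⟩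
  intro ℓ T' hT'
  have hlow : ∀ p, cell p ∈ S → δ ≤ imp Δ p (S.image (fun j => ((nx j : ℝ) + 1) * δ)) := by
    intro p hp
    have hne : ((S.image (fun j => ((nx j : ℝ) + 1) * δ)).filter
        (fun τ => p < τ ∧ τ ≤ p + Δ)).Nonempty := by
      refine ⟨((nx (cell p) : ℝ) + 1) * δ, ?_⟩
      rw [Finset.mem_filter]
      refine ⟨Finset.mem_image_of_mem _ hp, ?_, ?_⟩
      · refine (hc2 p).trans_le ?_
        have : (cell p : ℝ) ≤ nx (cell p) := by exact_mod_cast hn1 (cell p)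
        gcongr
      · have h1 : (nx (cell p) : ℝ) ≤ cell p + 2 * g := by exact_mod_cast hn2 (cell p)
        have h2 : ((nx (cell p) : ℝ) + 1) * δ ≤ (cell p + M) * δ := by
          apply mul_le_mul_of_nonneg_right _ hδ.le
          linarith
        rw [hΔδ]
        linarith [hc1 p]
    unfold imp
    rw [dif_pos hne]
    have hmem := Finset.min'_mem _ hne
    rw [Finset.mem_filter, Finset.mem_image] at hmem
    obtain ⟨⟨j, _, hj⟩, hlt, _⟩ := hmem
    rw [← hj] at hlt ⊢
    have h1 : (cell p : ℝ) < (nx j : ℝ) + 1 :=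
      lt_of_mul_lt_mul_right ((hc1 p).trans_lt hlt) hδ.le
    have h2 : cell p < nx j + 1 := by exact_mod_cast h1
    have h3 : cell p ≠ nx j := fun h => hn3 j (h ▸ hp)
    have h4 : cell p + 1 ≤ nx j := by omega
    have h5 : (cell p : ℝ) + 1 ≤ nx j := by exact_mod_cast h4
    have h6 : ((cell p : ℝ) + 1) * δ ≤ nx j * δ := mul_le_mul_of_nonneg_right h5 hδ.le
    linarith [hc2 p]
  have hL := sw_lower Δ δ (G ℓ) _ cell S hlow
  -- the upper bound
  set C : Finset ℤ := T'.image (fun τ => cell τ / (M : ℤ)) ∪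
    T'.image (fun τ => cell τ / (M : ℤ) - 1) with hC
  have hCcard : C.card ≤ 4 * q := by
    have h1 : C.card ≤ T'.card + T'.card :=
      (Finset.card_union_le _ _).trans (add_le_add Finset.card_image_le Finset.card_image_le)
    have h2 : (k + g - 1) / g ≤ 2 * q := by
      have hq1 : 1 ≤ q := by rw [hq]; exact (Nat.one_le_div_iff (by omega)).2 hk
      have h3 : (k + g - 1) / g ≤ (k + g) / g := Nat.div_le_div_right (by omega)
      rw [Nat.add_div_right _ (by omega), ← hq] at h3
      omega
    omega
  have hU := sw_upper Δ (G ℓ) T' (fun p => cell p / (M : ℤ)) C hΔ (by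
    intro p τ hτ h1 h2
    have a1 : cell p ≤ cell τ := by
      rw [hcell, hcell]; apply Int.floor_le_floor; gcongr
    have a2 : cell τ ≤ cell p + 1 * (M : ℤ) := by
      have : (cell τ : ℝ) < (cell p : ℝ) + 1 + M := by
        refine lt_of_mul_lt_mul_right ?_ hδ.le
        rw [hΔδ] at h2
        linarith [hc1 τ, hc2 p]
      have : cell τ < cell p + 1 + M := by exact_mod_cast this
      omega
    have b1 := Int.ediv_le_ediv hMz a1
    have b2 := Int.ediv_le_ediv hMz a2
    rw [Int.add_mul_ediv_right _ _ hMz.ne'] at b2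
    simp only [hC, Finset.mem_union, Finset.mem_image]
    have : cell τ / (M : ℤ) = cell p / (M : ℤ) ∨ cell τ / (M : ℤ) - 1 = cell p / (M : ℤ) := by
      omega
    rcases this with h | h
    · exact Or.inl ⟨τ, hτ, h⟩
    · exact Or.inr ⟨τ, hτ, h⟩)
  have hCB := best_mul (G ℓ) _ q _ (hBm ℓ) 4 C hCcard
  have hBS : cnt (G ℓ) (fun p => cell p / (M : ℤ)) (B ℓ) ≤ M * cnt (G ℓ) cell S := by
    have hinj : Set.InjOn (r ℓ) (B ℓ) := by
      intro x _ y _ hxy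
      rw [← hr1 ℓ x, ← hr1 ℓ y, hxy]
    calc _ = ∑ i ∈ B ℓ, cnt (G ℓ) (fun p => cell p / (M : ℤ)) {i} := cnt_sum _ _ _
      _ ≤ ∑ i ∈ B ℓ, M * cnt (G ℓ) cell {r ℓ i} := Finset.sum_le_sum fun i _ => hr2 ℓ i
      _ = M * ∑ j ∈ (B ℓ).image (r ℓ), cnt (G ℓ) cell {j} := by
        rw [← Finset.mul_sum, Finset.sum_image hinj]
      _ = M * cnt (G ℓ) cell ((B ℓ).image (r ℓ)) := by rw [← cnt_sum]
      _ ≤ M * cnt (G ℓ) cell S := Nat.mul_le_mul_left _ (cnt_mono _ _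
        (Finset.subset_biUnion_of_mem (fun ℓ => (B ℓ).image (r ℓ)) (Finset.mem_univ ℓ)))
  have hfin : (cnt (G ℓ) (fun p => cell p / (M : ℤ)) C : ℝ) ≤ 4 * (M * cnt (G ℓ) cell S) := by
    exact_mod_cast hCB.trans (Nat.mul_le_mul_left 4 hBS)
  have hU2 : swM Δ (G ℓ) T' ≤ 64 * (g : ℝ) ^ 2 * swM Δ (G ℓ)
      (S.image (fun j => ((nx j : ℝ) + 1) * δ)) := by
    calc _ ≤ _ := hU
      _ ≤ Δ * (4 * (M * cnt (G ℓ) cell S)) := mul_le_mul_of_nonneg_left hfin hΔ.le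
      _ = 64 * (g : ℝ) ^ 2 * (δ * cnt (G ℓ) cell S) := by rw [hΔδ, hMg]; ring
      _ ≤ _ := mul_le_mul_of_nonneg_left hL (by positivity)
  have hg0 : (0 : ℝ) < g := by linarith
  rw [div_div, one_div, inv_mul_le_iff₀ (by positivity)]
  exact hU2
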